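/- arXiv:math/0403246 — 3 statements merged into one kernel-verified Lean document; each statement's English description precedes it below -/
import Mathlib

section
/- Suppose A, B, C, D ∈ End(ℂⁿ⊗ℂⁿ) satisfy the Yang–Baxter consistency relations and the unitarity conditions. For an ordered label set M = ⟨1,…,m⟩ define L_M := A₁₂A₁₃⋯A₁ₘ A₂₃⋯A₂ₘ ⋯ A_{m−1,m} (the product of A_{ij} over all pairs 1 ≤ i < j ≤ m, ordered lexicographically). Then for all disjoint ordered label sets M, N′: L_M A_{MN̄′} = A_{M̄N̄′} L_M; L_{N′} A_{MN̄′} = A_{MN′} L_{N′}; L_{N′} B_{MN′} = B_{MN̄′} L_{N′}; and L_M C_{MN′} = C_{M̄N′} L_M. -/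
open Matrix

namespace QT

variable {n : ℕ} {ι : Type*} [Fintype ι] [DecidableEq ι] {α : Type*}
variable {R : Type*} [Ring R] [Algebra ℂ R]

/-- Operators on `V^{⊗ι}`, `V = ℂⁿ`, with entries in `α`. -/
abbrev Tens (ι : Type*) (n : ℕ) (α : Type*) := Matrix (ι → Fin n) (ι → Fin n) α

/-- Two-site matrices, i.e. elements of `End(V ⊗ V)` with entries in `α`. -/
abbrev M2 (n : ℕ) (α : Type*) := Matrix (Fin n × Fin n) (Fin n × Fin n) α

/-- `X_{ij}` : embedding of a two-site matrix at the (distinct) sites `i, j`,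
acting as the identity elsewhere. -/
noncomputable def emb2 [MulZeroOneClass α] (X : M2 n α) (i j : ι) : Tens ι n α :=
  Matrix.of fun f g =>
    if ∀ k, k ≠ i → k ≠ j → f k = g k then X (f i, f j) (g i, g j) else 0

/-- `T_i` : embedding of a one-site matrix at site `i`. -/
noncomputable def emb1 [Zero α] (T : Matrix (Fin n) (Fin n) α) (i : ι) : Tens ι n α :=
  Matrix.of fun f g => if ∀ k, k ≠ i → f k = g k then T (f i) (g i) else 0

/-- Fused matrix `X_{MN} = ∏→_{i∈M} ∏→_{j∈N} X_{ij}` (a bar, i.e. reversal of one of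
the ordered label sets, is obtained by passing `M.reverse` or `N.reverse`). -/
noncomputable def fuse [Semiring α] (X : M2 n α) (M N : List ι) : Tens ι n α :=
  (M.map fun i => (N.map fun j => emb2 X i j).prod).prod

/-- Partial transposition `t_S` in the factors labelled by `S`. -/
noncomputable def ptrans (S : Finset ι) (X : Tens ι n α) : Tens ι n α :=
  Matrix.of fun f g =>
    X (fun k => if k ∈ S then g k else f k) (fun k => if k ∈ S then f k else g k)

/-- Partial transposition `t₁` on a two-site matrix. -/
noncomputable def t1 (X : M2 n α) : M2 n α :=
  Matrix.of fun p q => X (q.1, p.2) (p.1, q.2)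

/-- Partial transposition `t₂` on a two-site matrix. -/
noncomputable def t2 (X : M2 n α) : M2 n α :=
  Matrix.of fun p q => X (p.1, q.2) (q.1, p.2)

/-- `X₂₁ = P X₁₂ P` : permutation of the two factors of a two-site matrix. -/
noncomputable def perm2 (X : M2 n α) : M2 n α :=
  Matrix.of fun p q => X (p.2, p.1) (q.2, q.1)

/-- The permutation (flip) matrix `P` on `V ⊗ V`. -/
noncomputable def PM (n : ℕ) (α : Type*) [Zero α] [One α] : M2 n α :=
  Matrix.of fun p q => if p.1 = q.2 ∧ p.2 = q.1 then 1 else 0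

/-- Index type for `V^{⊗M}`. -/
abbrev idx (n : ℕ) {ι : Type*} [DecidableEq ι] (M : List ι) :=
  {x // x ∈ M.toFinset} → Fin n

/-- Embedding `End(V^{⊗M}) ⊗ R → End(V^{⊗ι}) ⊗ R`, acting as the identity off `M`. -/
noncomputable def embS [Zero α] (M : List ι) (X : Matrix (idx n M) (idx n M) α) :
    Tens ι n α :=
  Matrix.of fun f g =>
    if ∀ k, k ∉ M.toFinset → f k = g k then
      X (fun i => f i.1) (fun i => g i.1) else 0

/-- A pair of disjoint ordered label sets. -/
def OkPair (M N : List ι) : Prop := M.Nodup ∧ N.Nodup ∧ M.Disjoint N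

/-- Fused solution `T_M = ∏→_{i∈M} ( T_i ∏→_{j∈M, j>i} B_{ij} )` of the quadratic
exchange algebra (also used for the dual fusion, with `B` replaced by the
appropriate dual structure matrix). -/
noncomputable def fuseT (B : M2 n ℂ) (T : Matrix (Fin n) (Fin n) R) :
    List ι → Tens ι n R
  | [] => 1
  | i :: M => emb1 T i *
      ((M.map fun j => (emb2 B i j).map (algebraMap ℂ R)).prod) * fuseT B T M

/-- The chain `X̌_{i₁i₂} X̌_{i₂i₃} ⋯ X̌_{i_{m-1}i_m}` along the ordered label set,
where `X̌_{ij} = P_{ij} X_{ij}`. -/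
noncomputable def chainCheck (X : M2 n ℂ) : List ι → Tens ι n ℂ
  | [] => 1
  | [_] => 1
  | i :: j :: M => emb2 (PM n ℂ * X) i j * chainCheck X (j :: M)

/-- The lexicographically ordered product `L_M = ∏_{i<j ∈ M} A_{ij}`. -/
noncomputable def lexA (A : M2 n ℂ) : List ι → Tens ι n ℂ
  | [] => 1
  | i :: M => (M.map fun j => emb2 A i j).prod * lexA A M

/-- DKM-type fused solution
`T̃_M = ∏→_{i∈M} ( (∏→_{j>i} A_{ij}) T_i (∏←_{j>i} B_{ij}) )`. -/
noncomputable def fuseT2 (A B : M2 n ℂ) (T : Matrix (Fin n) (Fin n) R) :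
    List ι → Tens ι n R
  | [] => 1
  | i :: M => ((M.map fun j => emb2 A i j).prod).map (algebraMap ℂ R) * emb1 T i *
      ((M.reverse.map fun j => emb2 B i j).prod).map (algebraMap ℂ R) * fuseT2 A B T M

/-! ### Dynamical setting -/

/-- the space of dynamical parameters `λ ∈ ℂⁿ`. -/
abbrev Lam (n : ℕ) := Fin n → ℂ

/-- standard basis vector `e_a` of `ℂⁿ`. -/
noncomputable def ee {n : ℕ} (a : Fin n) : Lam n := Pi.single a 1

/-- `Σ_{k∈S} e_{f k}` : the dynamical shift read off the indices at the factors in `S`. -/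
noncomputable def shL (S : Finset ι) (f : ι → Fin n) : Lam n := ∑ k ∈ S, ee (f k)

/-- The dynamical shift `X(λ + h_S)` of a matrix-valued function of `λ` (which is
assumed to act as the identity on the factors labelled by `S`). -/
noncomputable def dsh (S : Finset ι) (X : Lam n → Tens ι n α) : Lam n → Tens ι n α :=
  fun lam => Matrix.of fun f g => X (lam + shL S f) f g

/-- Dynamical structure matrices `ℂⁿ → End(V⊗V)`. -/
abbrev DSM (n : ℕ) := Lam n → M2 n ℂ

/-- Fused `A_{MN̄′}` (no dynamical shifts occur in the recursion for `A`). -/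
noncomputable def fuseAd (A : DSM n) (M N : List ι) : Lam n → Tens ι n ℂ :=
  fun lam => fuse (A lam) M N.reverse

/-- Fused `B_{MN′} = B_{1N′} ⋅ B_{M₀N′}(λ+h₁)`. -/
noncomputable def fuseBd (B : DSM n) : List ι → List ι → Lam n → Tens ι n ℂ
  | [], _ => fun _ => 1
  | i :: M, N => fun lam =>
      ((N.map fun j => emb2 (B lam) i j).prod) * dsh {i} (fuseBd B M N) lam

/-- Fused `C_{MN′} = C_{M1′} ⋅ C_{MN′₀}(λ+h_{1′})`. -/
noncomputable def fuseCd (C : DSM n) : List ι → List ι → Lam n → Tens ι n ℂ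
  | _, [] => fun _ => 1
  | M, j :: N => fun lam =>
      ((M.map fun i => emb2 (C lam) i j).prod) * dsh {j} (fuseCd C M N) lam

/-- Fused `D_{iN̄′} = D_{in′}(λ+h_{(1′,n′-1)}) ⋅ D_{i,(N̄′)₀}` (`Nr` is the reversed `N′`). -/
noncomputable def fuseD1 (D : DSM n) (i : ι) : List ι → Lam n → Tens ι n ℂ
  | [] => fun _ => 1
  | j :: Nr => fun lam =>
      dsh Nr.toFinset (fun mu => emb2 (D mu) i j) lam * fuseD1 D i Nr lam

/-- Fused `D_{MN̄′} = D_{1N̄′} ⋅ D_{M₀N̄′}(λ+h₁)`. -/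
noncomputable def fuseDd (D : DSM n) : List ι → List ι → Lam n → Tens ι n ℂ
  | [], _ => fun _ => 1
  | i :: M, N => fun lam => fuseD1 D i N.reverse lam * dsh {i} (fuseDd D M N) lam

/-- zero-weight condition on the first factor: `[B₁₂, h⊗1] = 0` for all diagonal `h`. -/
def WB (B : DSM n) : Prop := ∀ lam (d : Fin n → ℂ),
  B lam * Matrix.diagonal (fun p => d p.1) = Matrix.diagonal (fun p => d p.1) * B lam

/-- zero-weight condition on the second factor: `[C₁₂, 1⊗h] = 0` for all diagonal `h`. -/
def WC (C : DSM n) : Prop := ∀ lam (d : Fin n → ℂ),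
  C lam * Matrix.diagonal (fun p => d p.2) = Matrix.diagonal (fun p => d p.2) * C lam

/-- total zero-weight condition: `[D₁₂, h⊗1 + 1⊗h] = 0` for all diagonal `h`. -/
def WD (D : DSM n) : Prop := ∀ lam (d : Fin n → ℂ),
  D lam * Matrix.diagonal (fun p => d p.1 + d p.2)
    = Matrix.diagonal (fun p => d p.1 + d p.2) * D lam

/-- The four coupled semi-dynamical Yang–Baxter equations, on `V⊗V⊗V`. -/
def SDYB (A B C D : DSM n) : Prop :=
  (∀ lam, emb2 (ι := Fin 3) (A lam) 0 1 * emb2 (A lam) 0 2 * emb2 (A lam) 1 2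
      = emb2 (A lam) 1 2 * emb2 (A lam) 0 2 * emb2 (A lam) 0 1) ∧
  (∀ lam, dsh {2} (fun mu => emb2 (ι := Fin 3) (D mu) 0 1) lam * emb2 (D lam) 0 2 *
        dsh {0} (fun mu => emb2 (D mu) 1 2) lam
      = emb2 (D lam) 1 2 * dsh {1} (fun mu => emb2 (D mu) 0 2) lam * emb2 (D lam) 0 1) ∧
  (∀ lam, emb2 (ι := Fin 3) (D lam) 0 1 * emb2 (B lam) 0 2 *
        dsh {0} (fun mu => emb2 (B mu) 1 2) lam
      = emb2 (B lam) 1 2 * dsh {1} (fun mu => emb2 (B mu) 0 2) lam * emb2 (D lam) 0 1) ∧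
  (∀ lam, emb2 (ι := Fin 3) (A lam) 0 1 * emb2 (C lam) 0 2 * emb2 (C lam) 1 2
      = emb2 (C lam) 1 2 * emb2 (C lam) 0 2 * dsh {2} (fun mu => emb2 (A mu) 0 1) lam)

/-- Fused semi-dynamical solution
`T_M(λ) = ∏→_{i∈M} ( T_i(λ + h_{{k∈M : k<i}}) ∏→_{j∈M, j>i} B_{ij}(λ) )`. -/
noncomputable def fuseTd (B : DSM n) (T : Lam n → Matrix (Fin n) (Fin n) R)
    (M : List ι) : Lam n → Tens ι n R := fun lam =>
  (M.map fun i =>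
    dsh ((M.takeWhile (fun k => decide (k ≠ i))).toFinset)
        (fun mu => emb1 (T mu) i) lam *
    ((((M.dropWhile (fun k => decide (k ≠ i))).tail).map fun j =>
        emb2 (B lam) i j).prod).map (algebraMap ℂ R)).prod


/-! ### Noncommutative products over lists -/

section Monoid

variable {κ S : Type*} [Monoid S]

theorem commute_map_prod {c : S} {x : κ → S} {L : List κ} (h : ∀ k ∈ L, Commute c (x k)) :
    Commute c (L.map x).prod :=
  Commute.list_prod_right _ _ (by simpa using h)

theorem mul_map_prod_eq_map_prod_mul {c : S} {x y : κ → S} {L : List κ}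
    (h : ∀ k ∈ L, c * x k = y k * c) : c * (L.map x).prod = (L.map y).prod * c := by
  induction L with
  | nil => simp
  | cons k L ih =>
    simp only [List.mem_cons, forall_eq_or_imp] at h
    simp only [List.map_cons, List.prod_cons]
    rw [← mul_assoc, h.1, mul_assoc, ih h.2, mul_assoc]

/-- A product of elements `a j` moves through `y` followed by the reversed product of the `x j`. -/
theorem map_prod_mul_reverse_prod {a x : κ → S} {y : S} {L : List κ} (hL : L.Nodup)
    (hc : ∀ j ∈ L, ∀ k ∈ L, j ≠ k → Commute (a j) (x k))
    (h : ∀ j ∈ L, a j * y * x j = x j * y * a j) :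
    (L.map a).prod * (y * (L.reverse.map x).prod)
      = (L.reverse.map x).prod * y * (L.map a).prod := by
  induction L with
  | nil => simp
  | cons j L ih =>
    obtain ⟨hj, hL⟩ := List.nodup_cons.1 hL
    have ih := ih hL (fun i hi k hk => hc i (by simp [hi]) k (by simp [hk]))
      (fun i hi => h i (by simp [hi]))
    have hax : Commute (a j) (L.reverse.map x).prod := commute_map_prod fun k hk => by
      have hk := List.mem_reverse.1 hk
      exact hc j (by simp) k (by simp [hk]) (by rintro rfl; exact hj hk)
    have hxa : Commute (x j) (L.map a).prod := commute_map_prod fun k hk =>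
      (hc k (by simp [hk]) j (by simp) (by rintro rfl; exact hj hk)).symm
    simp only [List.map_cons, List.prod_cons, List.reverse_cons, List.map_append,
      List.prod_append, List.map_nil, List.prod_nil, mul_one]
    generalize (L.map a).prod = P at *
    generalize (L.reverse.map x).prod = X at *
    calc a j * P * (y * (X * x j)) = a j * (P * (y * X)) * x j := by simp only [mul_assoc]
      _ = (a j * X) * y * (P * x j) := by rw [ih]; simp only [mul_assoc]
      _ = X * (a j * y * x j) * P := by rw [hax.eq, ← hxa.eq]; simp only [mul_assoc]
      _ = X * x j * y * (a j * P) := by rw [h j (by simp)]; simp only [mul_assoc]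

/-- A product of elements `a j` moves through the product of the `x j` followed by `y`. -/
theorem map_prod_mul_prod {a x : κ → S} {y : S} {L : List κ} (hL : L.Nodup)
    (hc : ∀ j ∈ L, ∀ k ∈ L, j ≠ k → Commute (a j) (x k))
    (h : ∀ j ∈ L, a j * x j * y = y * x j * a j) :
    (L.map a).prod * ((L.map x).prod * y) = y * (L.map x).prod * (L.map a).prod := by
  induction L with
  | nil => simp
  | cons j L ih =>
    obtain ⟨hj, hL⟩ := List.nodup_cons.1 hL
    have ih := ih hL (fun i hi k hk => hc i (by simp [hi]) k (by simp [hk]))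
      (fun i hi => h i (by simp [hi]))
    have hax : Commute (a j) (L.map x).prod := commute_map_prod fun k hk =>
      hc j (by simp) k (by simp [hk]) (by rintro rfl; exact hj hk)
    have hxa : Commute (x j) (L.map a).prod := commute_map_prod fun k hk =>
      (hc k (by simp [hk]) j (by simp) (by rintro rfl; exact hj hk)).symm
    simp only [List.map_cons, List.prod_cons]
    generalize (L.map a).prod = P at *
    generalize (L.map x).prod = X at *
    calc a j * P * (x j * X * y) = a j * (P * x j) * (X * y) := by simp only [mul_assoc]
      _ = a j * x j * (P * (X * y)) := by rw [← hxa.eq]; simp only [mul_assoc]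
      _ = (a j * x j * y) * X * P := by rw [ih]; simp only [mul_assoc]
      _ = y * x j * (a j * X) * P := by rw [h j (by simp)]; simp only [mul_assoc]
      _ = y * (x j * X) * (a j * P) := by rw [hax.eq]; simp only [mul_assoc]

/-- A Yang–Baxter type relation holds for products if it holds factorwise and the remaining
factors commute. -/
theorem mul_prod_mul_prod {c : S} {u v : κ → S} {L : List κ} (hL : L.Nodup)
    (hc : ∀ k ∈ L, ∀ l ∈ L, k ≠ l → Commute (u k) (v l))
    (h : ∀ k ∈ L, c * u k * v k = v k * u k * c) :
    c * (L.map u).prod * (L.map v).prod = (L.map v).prod * (L.map u).prod * c := by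
  induction L with
  | nil => simp
  | cons k L ih =>
    obtain ⟨hk, hL⟩ := List.nodup_cons.1 hL
    have ih := ih hL (fun i hi l hl => hc i (by simp [hi]) l (by simp [hl]))
      (fun i hi => h i (by simp [hi]))
    have huv : Commute (u k) (L.map v).prod := commute_map_prod fun l hl =>
      hc k (by simp) l (by simp [hl]) (by rintro rfl; exact hk hl)
    have hvu : Commute (v k) (L.map u).prod := commute_map_prod fun l hl =>
      (hc l (by simp [hl]) k (by simp) (by rintro rfl; exact hk hl)).symm
    simp only [List.map_cons, List.prod_cons]
    generalize (L.map u).prod = U at *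
    generalize (L.map v).prod = W at *
    calc c * (u k * U) * (v k * W) = c * u k * (U * v k) * W := by simp only [mul_assoc]
      _ = (c * u k * v k) * U * W := by rw [← hvu.eq]; simp only [mul_assoc]
      _ = v k * u k * (c * U * W) := by rw [h k (by simp)]; simp only [mul_assoc]
      _ = v k * (u k * W) * U * c := by rw [ih]; simp only [mul_assoc]
      _ = v k * W * (u k * U) * c := by rw [huv.eq]; simp only [mul_assoc]

end Monoid

/-! ### Embedded matrices -/

theorem emb2_perm2 (X : M2 n ℂ) (i j : ι) : emb2 (perm2 X) i j = emb2 X j i := by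
  ext f g
  simp only [emb2, perm2, Matrix.of_apply]
  exact if_congr (forall_congr' fun k => ⟨fun h a b => h b a, fun h a b => h b a⟩) rfl rfl

theorem emb2_mul_emb2_apply (X Y : M2 n ℂ) {i j k l : ι} (hik : i ≠ k) (hil : i ≠ l)
    (hjk : j ≠ k) (hjl : j ≠ l) (f g : ι → Fin n) :
    (emb2 X i j * emb2 Y k l) f g =
      if ∀ m, m ≠ i → m ≠ j → m ≠ k → m ≠ l → f m = g m then
        X (f i, f j) (g i, g j) * Y (f k, f l) (g k, g l) else 0 := by
  rw [Matrix.mul_apply,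
    Finset.sum_eq_single (fun m => if m = i ∨ m = j then g m else f m)]
  · have hf : ∀ m, m ≠ i → m ≠ j → f m = if m = i ∨ m = j then g m else f m := by
      intro m hi hj
      simp [hi, hj]
    have hg : (∀ m, m ≠ k → m ≠ l → (if m = i ∨ m = j then g m else f m) = g m) ↔
        ∀ m, m ≠ i → m ≠ j → m ≠ k → m ≠ l → f m = g m := by
      refine forall_congr' fun m => ?_
      by_cases hi : m = i <;> by_cases hj : m = j <;> simp [hi, hj]
    simp only [emb2, Matrix.of_apply, if_pos hf, hg, mul_ite, mul_zero]
    simp [hik.symm, hil.symm, hjk.symm, hjl.symm]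
  · intro h _ hh
    by_contra hne
    refine hh (funext fun m => ?_)
    simp only [emb2, Matrix.of_apply, mul_ite, ite_mul, zero_mul, mul_zero] at hne
    split_ifs at hne with h1 h2
    · split_ifs with hm
      · rcases hm with rfl | rfl
        · exact h1 _ hik hil
        · exact h1 _ hjk hjl
      · push Not at hm
        exact (h2 m hm.1 hm.2).symm
    all_goals exact absurd rfl hne
  · simp

theorem emb2_commute (X Y : M2 n ℂ) {i j k l : ι} (hik : i ≠ k) (hil : i ≠ l)
    (hjk : j ≠ k) (hjl : j ≠ l) : Commute (emb2 X i j) (emb2 Y k l) := by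
  ext f g
  rw [emb2_mul_emb2_apply X Y hik hil hjk hjl,
    emb2_mul_emb2_apply Y X hik.symm hjk.symm hil.symm hjl.symm, mul_comm]
  exact if_congr (forall_congr' fun m => by tauto) rfl rfl

/-- Embedding of an operator on `V^{⊗κ}` along a map of label sets `σ : κ → ι`, acting as the
identity off the range of `σ`. -/
noncomputable def embMap {κ : Type*} [Fintype κ] (σ : κ → ι) (Z : Tens κ n ℂ) :
    Tens ι n ℂ :=
  Matrix.of fun f g => if ∀ k, (∀ a, k ≠ σ a) → f k = g k then Z (f ∘ σ) (g ∘ σ) else 0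

theorem embMap_mul {κ : Type*} [Fintype κ] [DecidableEq κ] {σ : κ → ι}
    (hσ : Function.Injective σ) (Z W : Tens κ n ℂ) :
    embMap σ (Z * W) = embMap σ Z * embMap σ W := by
  ext f g
  rw [Matrix.mul_apply]
  have hoff : ∀ (u : κ → Fin n) k, (∀ a, k ≠ σ a) → Function.extend σ u f k = f k :=
    fun u k hk => Function.extend_apply' _ _ _ (by rintro ⟨a, rfl⟩; exact hk a rfl)
  have hon : ∀ u : κ → Fin n, Function.extend σ u f ∘ σ = u :=
    fun u => funext fun a => hσ.extend_apply _ _ _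
  have hinj : Function.Injective fun u : κ → Fin n => Function.extend σ u f :=
    fun u v huv => by rw [← hon u, ← hon v]; exact congrArg (· ∘ σ) huv
  rw [← Fintype.sum_of_injective _ hinj
    (fun u => embMap σ Z f (Function.extend σ u f) * embMap σ W (Function.extend σ u f) g) _
    (fun h hh => ?_) (fun _ => rfl)]
  · have hf : ∀ u : κ → Fin n, ∀ k, (∀ a, k ≠ σ a) → f k = Function.extend σ u f k :=
      fun u k hk => (hoff u k hk).symm
    have hg : ∀ u : κ → Fin n, (∀ k, (∀ a, k ≠ σ a) → Function.extend σ u f k = g k) ↔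
        ∀ k, (∀ a, k ≠ σ a) → f k = g k := fun u =>
      forall_congr' fun k => forall_congr' fun hk => by rw [hoff u k hk]
    simp only [embMap, Matrix.of_apply, if_pos (hf _), hg, hon, Matrix.mul_apply, mul_ite,
      mul_zero]
    split_ifs <;> simp
  · have hne : ¬ ∀ k, (∀ a, k ≠ σ a) → f k = h k := fun hfh => hh ⟨h ∘ σ, funext fun k => by
      by_cases hk : ∃ a, σ a = k
      · obtain ⟨a, rfl⟩ := hk
        exact hσ.extend_apply _ _ _
      · exact (Function.extend_apply' _ _ _ hk).trans (hfh k fun a ha => hk ⟨a, ha.symm⟩)⟩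
    simp only [embMap, Matrix.of_apply, if_neg hne, zero_mul]

theorem embMap_emb2 {κ : Type*} [Fintype κ] [DecidableEq κ] {σ : κ → ι}
    (hσ : Function.Injective σ) (X : M2 n ℂ) (a b : κ) :
    embMap σ (emb2 X a b) = emb2 X (σ a) (σ b) := by
  ext f g
  simp only [embMap, emb2, Matrix.of_apply, Function.comp_apply, ← ite_and]
  refine if_congr ⟨fun h k ha hb => ?_, fun h => ⟨fun k hk => h k (hk a) (hk b),
    fun c ha hb => h _ (hσ.ne ha) (hσ.ne hb)⟩⟩ rfl rfl
  by_cases hk : ∃ c, σ c = k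
  · obtain ⟨c, rfl⟩ := hk
    exact h.2 c (fun e => ha (e ▸ rfl)) (fun e => hb (e ▸ rfl))
  · exact h.1 k fun c hc => hk ⟨c, hc.symm⟩

/-- A relation of Yang–Baxter type on `V ⊗ V ⊗ V` holds at any three distinct sites. -/
theorem emb2_yang_baxter {A X : M2 n ℂ}
    (h : emb2 (ι := Fin 3) A 0 1 * emb2 X 0 2 * emb2 X 1 2
      = emb2 X 1 2 * emb2 X 0 2 * emb2 A 0 1)
    {i j k : ι} (hij : i ≠ j) (hik : i ≠ k) (hjk : j ≠ k) :
    emb2 A i j * emb2 X i k * emb2 X j k = emb2 X j k * emb2 X i k * emb2 A i j := by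
  have hσ : Function.Injective ![i, j, k] := by
    intro a b hab
    fin_cases a <;> fin_cases b <;> simp_all
  simpa [embMap_mul hσ, embMap_emb2 hσ] using congrArg (embMap ![i, j, k]) h

/-! ### Intertwining by the lexicographic product -/

theorem commute_lexA {A : M2 n ℂ} {Y : Tens ι n ℂ} {M : List ι} (hM : M.Nodup)
    (h : ∀ i ∈ M, ∀ j ∈ M, i ≠ j → Commute Y (emb2 A i j)) : Commute Y (lexA A M) := by
  induction M with
  | nil => exact Commute.one_right Y
  | cons i M ih =>
    obtain ⟨hi, hM⟩ := List.nodup_cons.1 hM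
    refine Commute.mul_right (commute_map_prod fun j hj => h i (by simp) j (by simp [hj]) ?_)
      (ih hM fun j hj k hk => h j (by simp [hj]) k (by simp [hk]))
    rintro rfl
    exact hi hj

theorem lexA_mul_prod {A : M2 n ℂ} {x : ι → Tens ι n ℂ} {M : List ι} (hM : M.Nodup)
    (hc : ∀ i ∈ M, ∀ j ∈ M, ∀ k ∈ M, i ≠ k → j ≠ k → Commute (emb2 A i j) (x k))
    (h : ∀ i ∈ M, ∀ j ∈ M, i ≠ j → emb2 A i j * x i * x j = x j * x i * emb2 A i j) :
    lexA A M * (M.map x).prod = (M.reverse.map x).prod * lexA A M := by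
  induction M with
  | nil => simp
  | cons i M ih =>
    obtain ⟨hi, hM⟩ := List.nodup_cons.1 hM
    have hne : ∀ j ∈ M, i ≠ j := by rintro j hj rfl; exact hi hj
    have ih := ih hM
      (fun i hi j hj k hk => hc i (by simp [hi]) j (by simp [hj]) k (by simp [hk]))
      (fun i hi j hj => h i (by simp [hi]) j (by simp [hj]))
    have hx : Commute (x i) (lexA A M) := commute_lexA hM fun j hj k hk _ =>
      (hc j (by simp [hj]) k (by simp [hk]) i (by simp) (hne j hj).symm (hne k hk).symm).symm
    have hrow := map_prod_mul_reverse_prod (a := fun j => emb2 A i j) (y := x i) hM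
      (fun j hj k hk hjk => hc i (by simp) j (by simp [hj]) k (by simp [hk]) (hne k hk) hjk)
      (fun j hj => h i (by simp) j (by simp [hj]) (hne j hj))
    simp only [lexA, List.map_cons, List.prod_cons, List.reverse_cons, List.map_append,
      List.prod_append, List.map_nil, List.prod_nil, mul_one]
    rw [mul_assoc, ← mul_assoc (lexA A M), ← hx.eq, mul_assoc (x i), ih, ← mul_assoc (x i),
      ← mul_assoc, hrow, mul_assoc]

theorem lexA_mul_reverse_prod {A : M2 n ℂ} {x : ι → Tens ι n ℂ} {M : List ι} (hM : M.Nodup)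
    (hc : ∀ i ∈ M, ∀ j ∈ M, ∀ k ∈ M, i ≠ k → j ≠ k → Commute (emb2 A i j) (x k))
    (h : ∀ i ∈ M, ∀ j ∈ M, i ≠ j → emb2 A i j * x j * x i = x i * x j * emb2 A i j) :
    lexA A M * (M.reverse.map x).prod = (M.map x).prod * lexA A M := by
  induction M with
  | nil => simp
  | cons i M ih =>
    obtain ⟨hi, hM⟩ := List.nodup_cons.1 hM
    have hne : ∀ j ∈ M, i ≠ j := by rintro j hj rfl; exact hi hj
    have ih := ih hM
      (fun i hi j hj k hk => hc i (by simp [hi]) j (by simp [hj]) k (by simp [hk]))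
      (fun i hi j hj => h i (by simp [hi]) j (by simp [hj]))
    have hx : Commute (x i) (lexA A M) := commute_lexA hM fun j hj k hk _ =>
      (hc j (by simp [hj]) k (by simp [hk]) i (by simp) (hne j hj).symm (hne k hk).symm).symm
    have hrow := map_prod_mul_prod (a := fun j => emb2 A i j) (y := x i) hM
      (fun j hj k hk hjk => hc i (by simp) j (by simp [hj]) k (by simp [hk]) (hne k hk) hjk)
      (fun j hj => h i (by simp) j (by simp [hj]) (hne j hj))
    simp only [lexA, List.map_cons, List.prod_cons, List.reverse_cons, List.map_append,
      List.prod_append, List.map_nil, List.prod_nil, mul_one]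
    rw [mul_assoc, ← mul_assoc (lexA A M), ih, mul_assoc _ (lexA A M), ← hx.eq,
      ← mul_assoc _ (x i), ← mul_assoc, hrow, mul_assoc]

/-- The lexicographic product reverses the first label set of a fused matrix. -/
theorem lexA_mul_fuse_left {A X : M2 n ℂ}
    (h : emb2 (ι := Fin 3) A 0 1 * emb2 X 0 2 * emb2 X 1 2
      = emb2 X 1 2 * emb2 X 0 2 * emb2 A 0 1)
    {M N : List ι} (hMN : OkPair M N) :
    lexA A M * fuse X M N = fuse X M.reverse N * lexA A M := by
  obtain ⟨hM, hN, hd⟩ := hMN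
  have hne : ∀ i ∈ M, ∀ k ∈ N, i ≠ k := by rintro i hi k hk rfl; exact hd hi hk
  refine lexA_mul_prod hM (fun i hi j hj k _ hik hjk => commute_map_prod fun l hl =>
    emb2_commute A X hik (hne i hi l hl) hjk (hne j hj l hl)) fun i hi j hj hij => ?_
  exact mul_prod_mul_prod hN
    (fun k hk l hl hkl => emb2_commute X X hij (hne i hi l hl) (hne j hj k hk).symm hkl)
    fun k hk => emb2_yang_baxter h hij (hne i hi k hk) (hne j hj k hk)

/-- the lexicographic product of `A`'s satisfies the coupling
(intertwining) relations. -/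
theorem lex_coupling {n : ℕ} (hn : 1 ≤ n)
    (A B C D : M2 n ℂ)
    (hYBA : emb2 (ι := Fin 3) A 0 1 * emb2 A 0 2 * emb2 A 1 2
          = emb2 A 1 2 * emb2 A 0 2 * emb2 A 0 1)
    (hYBAC : emb2 (ι := Fin 3) A 0 1 * emb2 C 0 2 * emb2 C 1 2
          = emb2 C 1 2 * emb2 C 0 2 * emb2 A 0 1)
    (hYBD : emb2 (ι := Fin 3) D 0 1 * emb2 D 0 2 * emb2 D 1 2
          = emb2 D 1 2 * emb2 D 0 2 * emb2 D 0 1)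
    (hYBDB : emb2 (ι := Fin 3) D 0 1 * emb2 B 0 2 * emb2 B 1 2
          = emb2 B 1 2 * emb2 B 0 2 * emb2 D 0 1)
    (hUA : A * perm2 A = 1) (hUD : D * perm2 D = 1) (hBC : B = perm2 C)
    {ι : Type} [Fintype ι] [DecidableEq ι] (M N : List ι) (hMN : OkPair M N) :
    lexA A M * fuse A M N.reverse = fuse A M.reverse N.reverse * lexA A M ∧
    lexA A N * fuse A M N.reverse = fuse A M N * lexA A N ∧
    lexA A N * fuse B M N = fuse B M N.reverse * lexA A N ∧
    lexA A M * fuse C M N = fuse C M.reverse N * lexA A M := by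
  obtain ⟨hM, hN, hd⟩ := hMN
  have hne : ∀ i ∈ M, ∀ k ∈ N, i ≠ k := by rintro i hi k hk rfl; exact hd hi hk
  refine ⟨lexA_mul_fuse_left hYBA ⟨hM, List.nodup_reverse.2 hN, by simpa using hd⟩,
    mul_map_prod_eq_map_prod_mul fun i hi => ?_, mul_map_prod_eq_map_prod_mul fun i hi => ?_,
    lexA_mul_fuse_left hYBAC ⟨hM, hN, hd⟩⟩
  · refine lexA_mul_reverse_prod hN (fun k hk l hl m _ hkm hlm => emb2_commute A A
      (hne i hi k hk).symm hkm (hne i hi l hl).symm hlm) fun k hk l hl hkl => ?_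
    rw [← emb2_yang_baxter hYBA (hne i hi k hk) (hne i hi l hl) hkl]
  · simp only [hBC, emb2_perm2]
    exact lexA_mul_prod hN (fun k hk l hl m _ hkm hlm => emb2_commute A C hkm
      (hne i hi k hk).symm hlm (hne i hi l hl).symm) fun k hk l hl hkl =>
        emb2_yang_baxter hYBAC hkl (hne i hi k hk).symm (hne i hi l hl).symm

end QT
end

section
/- Let {K_M ∈ End(V^{⊗M})⊗R} be a family satisfying the fused dual exchange relation (A_{MN̄′}⁻¹)^{t_M t_{N′}} K_M ((B_{MN′}^{t_M})⁻¹)^{t_{N′}} K_{N′} = K_{N′} ((C_{MN′}^{t_{N′}})⁻¹)^{t_M} K_M (D_{MN̄′}^{t_M t_{N′}})⁻¹ for all disjoint ordered label sets M, N′ (the indicated scalar matrices being invertible). Suppose scalar matrices L_M ∈ End(V^{⊗M}) satisfy the intertwining relations L_M A_{MN̄′} = A_{M̄N̄′} L_M, L_{N′} A_{MN̄′} = A_{MN′} L_{N′}, L_{N′} B_{MN′} = B_{MN̄′} L_{N′}, L_M C_{MN′} = C_{M̄N′} L_M, and that each L_M^{t_M} is invertible. Then K̃_M := (L_M^{t_M})⁻¹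 K_M satisfies the DKM-type fused dual exchange relation (A_{M̄N′}⁻¹)^{t_M t_{N′}} K̃_M ((B_{MN̄′}^{t_M})⁻¹)^{t_{N′}} K̃_{N′} = K̃_{N′} ((C_{M̄N′}^{t_{N′}})⁻¹)^{t_M} K̃_M (D_{MN̄′}^{t_M t_{N′}})⁻¹ for all disjoint M, N′. -/
open Matrix

namespace QT

variable {n : ℕ} {ι : Type*} [Fintype ι] [DecidableEq ι] {α : Type*}
variable {R : Type*} [Ring R] [Algebra ℂ R]

/-- Overwrite the entries of a multi-index `f` at the labels in `M` by those of `x`. -/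
def overwrite (M : List ι) (f : ι → Fin n) (x : idx n M) : ι → Fin n :=
  fun k => if h : k ∈ M.toFinset then x ⟨k, h⟩ else f k

lemma overwrite_restrict {κ : Type*} [DecidableEq κ] (M : List κ) (f : κ → Fin n)
    (x : idx n M) :
    (fun i : {x // x ∈ M.toFinset} => overwrite M f x i.1) = x := by
  funext i
  simp only [overwrite, i.2, dif_pos]

lemma eq_overwrite {κ : Type*} [DecidableEq κ] {M : List κ} {f h : κ → Fin n}
    (H : ∀ k, k ∉ M.toFinset → f k = h k) :
    h = overwrite M f (fun i => h i.1) := by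
  funext k
  by_cases hk : k ∈ M.toFinset
  · simp only [overwrite, hk, dif_pos]
  · simp only [overwrite, hk, dif_neg, not_false_eq_true, H k hk]

lemma eq_overwrite_off {κ : Type*} [DecidableEq κ] (M : List κ) (f : κ → Fin n) (x : idx n M)
    (k : κ) (hk : k ∉ M.toFinset) : f k = overwrite M f x k := by
  simp only [overwrite, hk, dif_neg, not_false_eq_true]

lemma embS_mul_apply [Semiring α] (M : List ι) (X : Matrix (idx n M) (idx n M) α)
    (Y : Tens ι n α) (f g : ι → Fin n) :
    (embS M X * Y) f g = ∑ x, X (fun i => f i.1) x * Y (overwrite M f x) g := by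
  rw [Matrix.mul_apply]
  symm
  refine Finset.sum_of_injOn (overwrite M f) ?_ (fun _ _ => Finset.mem_coe.2 (Finset.mem_univ _))
    ?_ ?_
  · intro x _ y _ hxy
    rw [← overwrite_restrict M f x, ← overwrite_restrict M f y, hxy]
  · intro h _ hh
    have : ¬ ∀ k, k ∉ M.toFinset → f k = h k := fun H =>
      hh ⟨_, Finset.mem_coe.2 (Finset.mem_univ _), (eq_overwrite H).symm⟩
    simp only [embS, Matrix.of_apply, if_neg this, zero_mul]
  · intro x _
    simp only [embS, Matrix.of_apply, if_pos (eq_overwrite_off M f x), overwrite_restrict]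

lemma embS_transpose [Zero α] (M : List ι) (X : Matrix (idx n M) (idx n M) α) :
    (embS M X)ᵀ = embS M Xᵀ := by
  ext f g
  simp only [embS, Matrix.transpose_apply, Matrix.of_apply, eq_comm]

lemma mul_embS_apply [CommSemiring α] (M : List ι) (X : Matrix (idx n M) (idx n M) α)
    (Y : Tens ι n α) (f g : ι → Fin n) :
    (Y * embS M X) f g = ∑ x, Y f (overwrite M g x) * X x (fun i => g i.1) := by
  rw [← Matrix.transpose_apply (Y * embS M X), Matrix.transpose_mul, embS_transpose,
    embS_mul_apply]
  simp only [Matrix.transpose_apply, mul_comm]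

lemma embS_mul [Semiring α] (M : List ι) (X Y : Matrix (idx n M) (idx n M) α) :
    embS M (X * Y) = embS M X * embS M Y := by
  ext f g
  rw [embS_mul_apply]
  have key (x : idx n M) : (∀ k, k ∉ M.toFinset → overwrite M f x k = g k) ↔
      ∀ k, k ∉ M.toFinset → f k = g k :=
    forall₂_congr fun k hk => by rw [eq_overwrite_off M f x k hk]
  simp only [embS, Matrix.of_apply, key, overwrite_restrict]
  split_ifs
  · rw [Matrix.mul_apply]
  · simp only [mul_zero, Finset.sum_const_zero]

lemma embS_one [Semiring α] (M : List ι) :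
    embS M (1 : Matrix (idx n M) (idx n M) α) = 1 := by
  ext f g
  simp only [embS, Matrix.of_apply, Matrix.one_apply, ← ite_and]
  congr 1
  refine propext ⟨fun ⟨h₁, h₂⟩ => funext fun k => ?_, fun h => by simp [h]⟩
  by_cases hk : k ∈ M.toFinset
  · exact congrFun h₂ ⟨k, hk⟩
  · exact h₁ k hk

lemma embS_map {β : Type*} [Zero α] [Zero β] (φ : α → β) (h0 : φ 0 = 0) (M : List ι)
    (X : Matrix (idx n M) (idx n M) α) : (embS M X).map φ = embS M (X.map φ) := by
  ext f g
  simp only [embS, Matrix.map_apply, Matrix.of_apply, apply_ite φ, h0]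

lemma embS_mul_embS_apply [Semiring α] {M N : List ι} (hMN : M.Disjoint N)
    (X : Matrix (idx n M) (idx n M) α) (Y : Matrix (idx n N) (idx n N) α) (f g : ι → Fin n) :
    (embS M X * embS N Y) f g =
      if ∀ k, k ∉ M.toFinset → k ∉ N.toFinset → f k = g k then
        X (fun i => f i.1) (fun i => g i.1) * Y (fun i => f i.1) (fun i => g i.1) else 0 := by
  have hd (k : ι) (h : k ∈ N.toFinset) : k ∉ M.toFinset := fun h' =>
    hMN (List.mem_toFinset.1 h') (List.mem_toFinset.1 h)
  rw [embS_mul_apply, Finset.sum_eq_single (fun i => g i.1)]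
  · have h₁ : (∀ k, k ∉ N.toFinset → overwrite M f (fun i => g i.1) k = g k) ↔
        ∀ k, k ∉ M.toFinset → k ∉ N.toFinset → f k = g k := by
      refine forall_congr' fun k => ?_
      by_cases hk : k ∈ M.toFinset <;> simp only [overwrite, hk] <;> simp
    have h₂ : (fun i : {x // x ∈ N.toFinset} => overwrite M f (fun i => g i.1) i.1) =
        fun i => f i.1 := funext fun i => (eq_overwrite_off M f _ i.1 (hd _ i.2)).symm
    simp only [embS, Matrix.of_apply, h₁, h₂, mul_ite, mul_zero]
  · intro x _ hx
    have : ¬ ∀ k, k ∉ N.toFinset → overwrite M f x k = g k := fun H => hx <| by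
      rw [← overwrite_restrict M f x]
      exact funext fun i => H i.1 fun h => hd _ h i.2
    simp only [embS, Matrix.of_apply, if_neg this, mul_zero]
  · exact fun h => (h (Finset.mem_univ _)).elim

lemma embS_commute [Semiring α] {M N : List ι} (hMN : M.Disjoint N)
    {X : Matrix (idx n M) (idx n M) α} {Y : Matrix (idx n N) (idx n N) α}
    (h : ∀ a b c d, Commute (X a b) (Y c d)) : Commute (embS M X) (embS N Y) := by
  ext f g
  rw [embS_mul_embS_apply hMN, embS_mul_embS_apply hMN.symm, (h _ _ _ _).eq]
  congr 1
  exact propext (forall_congr' fun _ => forall_comm)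

lemma ptrans_embS_mul_of_disjoint [CommSemiring α] {M N : List ι} (hMN : M.Disjoint N)
    (X : Matrix (idx n N) (idx n N) α) (Y : Tens ι n α) :
    ptrans M.toFinset (embS N X * Y) = embS N X * ptrans M.toFinset Y := by
  have hd (k : ι) (h : k ∈ N.toFinset) : k ∉ M.toFinset := fun h' =>
    hMN (List.mem_toFinset.1 h') (List.mem_toFinset.1 h)
  ext f g
  rw [embS_mul_apply]
  simp only [ptrans, Matrix.of_apply]
  rw [embS_mul_apply]
  refine Finset.sum_congr rfl fun x _ => ?_
  congr 2
  · exact funext fun i => if_neg (hd _ i.2)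
  · funext k
    by_cases hk : k ∈ N.toFinset
    · simp only [overwrite, hk, dif_pos, if_neg (hd k hk)]
    · simp only [overwrite, hk, dif_neg, not_false_eq_true]
  · funext k
    by_cases hk : k ∈ N.toFinset
    · simp only [if_neg (hd k hk)]
    · simp only [overwrite, hk, dif_neg, not_false_eq_true]

lemma ptrans_embS_mul_self [CommSemiring α] (M : List ι)
    (X : Matrix (idx n M) (idx n M) α) (Y : Tens ι n α) :
    ptrans M.toFinset (embS M X * Y) = ptrans M.toFinset Y * embS M Xᵀ := by
  ext f g
  rw [mul_embS_apply]
  simp only [ptrans, Matrix.of_apply]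
  rw [embS_mul_apply]
  refine Finset.sum_congr rfl fun x _ => ?_
  rw [mul_comm, Matrix.transpose_apply]
  congr 2
  · funext k
    by_cases hk : k ∈ M.toFinset <;> simp only [overwrite, hk] <;> simp
  · funext k
    by_cases hk : k ∈ M.toFinset <;> simp only [overwrite, hk] <;> simp
  · exact funext fun i => if_pos i.2

lemma ptrans_transpose {κ : Type*} [DecidableEq κ] (S : Finset κ) (X : Tens κ n α) :
    ptrans S Xᵀ = (ptrans S X)ᵀ := rfl

lemma ptrans_mul_embS_of_disjoint [CommSemiring α] {M N : List ι} (hMN : M.Disjoint N)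
    (X : Matrix (idx n N) (idx n N) α) (Y : Tens ι n α) :
    ptrans M.toFinset (Y * embS N X) = ptrans M.toFinset Y * embS N X := by
  rw [← Matrix.transpose_inj, ← ptrans_transpose, Matrix.transpose_mul, Matrix.transpose_mul,
    embS_transpose, ptrans_embS_mul_of_disjoint hMN, ptrans_transpose]

lemma ptrans_mul_embS_self [CommSemiring α] (M : List ι)
    (X : Matrix (idx n M) (idx n M) α) (Y : Tens ι n α) :
    ptrans M.toFinset (Y * embS M X) = embS M Xᵀ * ptrans M.toFinset Y := by
  rw [← Matrix.transpose_inj, ← ptrans_transpose, Matrix.transpose_mul, Matrix.transpose_mul,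
    embS_transpose, embS_transpose, ptrans_embS_mul_self, ptrans_transpose]

lemma inv_mul_eq_mul_inv {κ : Type*} [Fintype κ] [DecidableEq κ] {U X Y : Matrix κ κ ℂ}
    (hX : IsUnit X) (hY : IsUnit Y) (h : U * X = Y * U) : Y⁻¹ * U = U * X⁻¹ := by
  rw [Matrix.isUnit_iff_isUnit_det] at hX hY
  calc Y⁻¹ * U = Y⁻¹ * (U * X) * X⁻¹ := by
        rw [mul_assoc, mul_assoc, Matrix.mul_nonsing_inv _ hX, mul_one]
    _ = U * X⁻¹ := by rw [h, ← mul_assoc, Matrix.nonsing_inv_mul _ hY, one_mul]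

lemma mul_inv_eq_inv_mul {S : Type*} [Monoid S] {U P X Y : S} (hUP : U * P = 1) (hPU : P * U = 1)
    (h : U * Y = X * U) : Y * P = P * X := by
  calc Y * P = P * (U * Y) * P := by rw [← mul_assoc P, hPU, one_mul]
    _ = P * X := by rw [h, mul_assoc, mul_assoc, hUP, mul_one]

/-- The image over `R` of the inverse transpose of a scalar matrix on the factors in `M`. -/
noncomputable def embInvT (R : Type*) [Ring R] [Algebra ℂ R] (M : List ι)
    (L : Matrix (idx n M) (idx n M) ℂ) : Tens ι n R :=
  embS M (((Lᵀ)⁻¹).map (algebraMap ℂ R))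

lemma embS_transpose_mul_embInvT {M : List ι} {L : Matrix (idx n M) (idx n M) ℂ}
    (hL : IsUnit Lᵀ) : (embS M Lᵀ).map (algebraMap ℂ R) * embInvT R M L = 1 := by
  rw [embInvT, embS_map _ (map_zero _), ← embS_mul, ← Matrix.map_mul,
    Matrix.mul_nonsing_inv _ ((Matrix.isUnit_iff_isUnit_det _).1 hL),
    Matrix.map_one _ (map_zero _) (map_one _), embS_one]

lemma embInvT_mul_embS_transpose {M : List ι} {L : Matrix (idx n M) (idx n M) ℂ}
    (hL : IsUnit Lᵀ) : embInvT R M L * (embS M Lᵀ).map (algebraMap ℂ R) = 1 := by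
  rw [embInvT, embS_map _ (map_zero _), ← embS_mul, ← Matrix.map_mul,
    Matrix.nonsing_inv_mul _ ((Matrix.isUnit_iff_isUnit_det _).1 hL),
    Matrix.map_one _ (map_zero _) (map_one _), embS_one]

/-- Intertwining by `L` on the factors in `N` passes to `(((·)^{t_M})⁻¹)^{t_N}`. -/
lemma ptrans_inv_ptrans_mul_embInvT {M N : List ι} (hMN : M.Disjoint N)
    {L : Matrix (idx n N) (idx n N) ℂ} (hL : IsUnit Lᵀ) {X Y : Tens ι n ℂ}
    (hX : IsUnit (ptrans M.toFinset X)) (hY : IsUnit (ptrans M.toFinset Y))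
    (h : embS N L * X = Y * embS N L) :
    (ptrans N.toFinset (ptrans M.toFinset Y)⁻¹).map (algebraMap ℂ R) * embInvT R N L =
      embInvT R N L * (ptrans N.toFinset (ptrans M.toFinset X)⁻¹).map (algebraMap ℂ R) := by
  have h₁ := congrArg (ptrans M.toFinset) h
  rw [ptrans_embS_mul_of_disjoint hMN, ptrans_mul_embS_of_disjoint hMN] at h₁
  have h₂ := congrArg (ptrans N.toFinset) (inv_mul_eq_mul_inv hX hY h₁)
  rw [ptrans_embS_mul_self, ptrans_mul_embS_self] at h₂
  refine mul_inv_eq_inv_mul (embS_transpose_mul_embInvT hL) (embInvT_mul_embS_transpose hL) ?_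
  rw [← Matrix.map_mul, ← Matrix.map_mul, h₂]

/-- Intertwining by `L_M L_N` passes to `((·)⁻¹)^{t_M t_N}`. -/
lemma ptrans_ptrans_inv_mul_embInvT {M N : List ι} (hMN : M.Disjoint N)
    {LM : Matrix (idx n M) (idx n M) ℂ} {LN : Matrix (idx n N) (idx n N) ℂ}
    (hLM : IsUnit LMᵀ) (hLN : IsUnit LNᵀ) {X Y : Tens ι n ℂ} (hX : IsUnit X) (hY : IsUnit Y)
    (h : embS M LM * embS N LN * X = Y * (embS M LM * embS N LN)) :
    (ptrans N.toFinset (ptrans M.toFinset Y⁻¹)).map (algebraMap ℂ R) *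
        (embInvT R M LM * embInvT R N LN) =
      embInvT R M LM * embInvT R N LN *
        (ptrans N.toFinset (ptrans M.toFinset X⁻¹)).map (algebraMap ℂ R) := by
  have h₁ : Y⁻¹ * embS M LM * embS N LN = embS N LN * (embS M LM * X⁻¹) := by
    rw [mul_assoc, inv_mul_eq_mul_inv hX hY h,
      (embS_commute hMN fun _ _ _ _ => Commute.all _ _).eq, mul_assoc]
  have h₂ := congrArg (ptrans M.toFinset) h₁
  rw [ptrans_mul_embS_of_disjoint hMN, ptrans_mul_embS_self, ptrans_embS_mul_of_disjoint hMN,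
    ptrans_embS_mul_self] at h₂
  have h₃ := congrArg (ptrans N.toFinset) h₂
  rw [ptrans_mul_embS_self, ptrans_embS_mul_of_disjoint hMN.symm, ptrans_embS_mul_self,
    ptrans_mul_embS_of_disjoint hMN.symm,
    mul_assoc, (embS_commute hMN fun _ _ _ _ => Commute.all _ _).eq] at h₃
  refine mul_inv_eq_inv_mul
    (U := (embS N LNᵀ).map (algebraMap ℂ R) * (embS M LMᵀ).map (algebraMap ℂ R)) ?_ ?_ ?_
  · rw [mul_assoc, ← mul_assoc _ (embInvT R M LM), embS_transpose_mul_embInvT hLM, one_mul,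
      embS_transpose_mul_embInvT hLN]
  · rw [mul_assoc, ← mul_assoc (embInvT R N LN), embInvT_mul_embS_transpose hLN, one_mul,
      embInvT_mul_embS_transpose hLM]
  · rw [← Matrix.map_mul, ← Matrix.map_mul, ← Matrix.map_mul]
    rw [mul_assoc, h₃]

lemma embInvT_commute_embS {M N : List ι} (hMN : M.Disjoint N)
    (L : Matrix (idx n M) (idx n M) ℂ) (X : Matrix (idx n N) (idx n N) R) :
    Commute (embInvT R M L) (embS N X) :=
  embS_commute hMN fun _ _ _ _ => Algebra.commutes _ _

lemma exchange_of_twist {S : Type*} [Monoid S] {a a' b b' c c' d P Q X Y : S}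
    (h : a * X * b * Y = Y * c * X * d) (ha : a' * (P * Q) = P * Q * a) (hb : b' * Q = Q * b)
    (hc : c' * P = P * c) (hQX : Q * X = X * Q) (hPY : P * Y = Y * P) (hPQ : P * Q = Q * P) :
    a' * (P * X) * b' * (Q * Y) = Q * Y * c' * (P * X) * d := by
  calc a' * (P * X) * b' * (Q * Y) = a' * P * X * (b' * Q) * Y := by simp only [mul_assoc]
    _ = a' * P * (X * Q) * b * Y := by rw [hb]; simp only [mul_assoc]
    _ = a' * (P * Q) * X * b * Y := by rw [← hQX]; simp only [mul_assoc]
    _ = P * Q * (a * X * b * Y) := by rw [ha]; simp only [mul_assoc]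
    _ = Q * (P * Y) * c * X * d := by rw [h, hPQ]; simp only [mul_assoc]
    _ = Q * Y * (P * c) * X * d := by rw [hPY]; simp only [mul_assoc]
    _ = Q * Y * c' * (P * X) * d := by rw [← hc]; simp only [mul_assoc]

/-- the coupling matrices turn solutions of the fused dual exchange
relation into solutions of the DKM-type fused dual exchange relation. -/
theorem coupling_dual_to_DKM {n : ℕ} (hn : 1 ≤ n)
    {ι : Type} [Fintype ι] [DecidableEq ι]
    {R : Type*} [Ring R] [Algebra ℂ R]
    (A B C D : M2 n ℂ)
    (K : (M : List ι) → Matrix (idx n M) (idx n M) R)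
    (L : (M : List ι) → Matrix (idx n M) (idx n M) ℂ)
    (hfA : ∀ M N : List ι, OkPair M N →
      IsUnit (fuse A M N.reverse) ∧ IsUnit (fuse A M.reverse N))
    (hfD : ∀ M N : List ι, OkPair M N → IsUnit (fuse D M N.reverse))
    (hfB : ∀ M N : List ι, OkPair M N →
      IsUnit (ptrans M.toFinset (fuse B M N)) ∧
      IsUnit (ptrans M.toFinset (fuse B M N.reverse)))
    (hfC : ∀ M N : List ι, OkPair M N →
      IsUnit (ptrans N.toFinset (fuse C M N)) ∧
      IsUnit (ptrans N.toFinset (fuse C M.reverse N)))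
    (hLt : ∀ M : List ι, IsUnit (L M)ᵀ)
    (hK : ∀ M N : List ι, OkPair M N →
      (ptrans N.toFinset (ptrans M.toFinset ((fuse A M N.reverse)⁻¹))).map (algebraMap ℂ R) *
        embS M (K M) *
        (ptrans N.toFinset ((ptrans M.toFinset (fuse B M N))⁻¹)).map (algebraMap ℂ R) *
        embS N (K N)
      = embS N (K N) *
        (ptrans M.toFinset ((ptrans N.toFinset (fuse C M N))⁻¹)).map (algebraMap ℂ R) *
        embS M (K M) *
        ((ptrans N.toFinset (ptrans M.toFinset (fuse D M N.reverse)))⁻¹).map (algebraMap ℂ R))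
    (hL : ∀ M N : List ι, OkPair M N →
      embS M (L M) * fuse A M N.reverse = fuse A M.reverse N.reverse * embS M (L M) ∧
      embS N (L N) * fuse A M N.reverse = fuse A M N * embS N (L N) ∧
      embS N (L N) * fuse B M N = fuse B M N.reverse * embS N (L N) ∧
      embS M (L M) * fuse C M N = fuse C M.reverse N * embS M (L M)) :
    ∀ M N : List ι, OkPair M N →
      (ptrans N.toFinset (ptrans M.toFinset ((fuse A M.reverse N)⁻¹))).map (algebraMap ℂ R) *
        embS M ((((L M)ᵀ)⁻¹).map (algebraMap ℂ R) * K M) *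
        (ptrans N.toFinset ((ptrans M.toFinset (fuse B M N.reverse))⁻¹)).map (algebraMap ℂ R) *
        embS N ((((L N)ᵀ)⁻¹).map (algebraMap ℂ R) * K N)
      = embS N ((((L N)ᵀ)⁻¹).map (algebraMap ℂ R) * K N) *
        (ptrans M.toFinset ((ptrans N.toFinset (fuse C M.reverse N))⁻¹)).map (algebraMap ℂ R) *
        embS M ((((L M)ᵀ)⁻¹).map (algebraMap ℂ R) * K M) *
        ((ptrans N.toFinset (ptrans M.toFinset (fuse D M N.reverse)))⁻¹).map (algebraMap ℂ R) := by
  intro M N hMN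
  obtain ⟨hM, hN, hd⟩ := hMN
  have hMN : OkPair M N := ⟨hM, hN, hd⟩
  have hMNr : OkPair M N.reverse :=
    ⟨hM, List.nodup_reverse.2 hN, fun k h h' => hd h (List.mem_reverse.1 h')⟩
  obtain ⟨-, hA₂, hB, hC⟩ := hL M N hMN
  have hA₁ := (hL M N.reverse hMNr).1
  rw [List.reverse_reverse] at hA₁
  have ha := ptrans_ptrans_inv_mul_embInvT (R := R) hd (hLt M) (hLt N) (hfA M N hMN).1
    (hfA M N hMN).2 (by rw [mul_assoc, hA₂, ← mul_assoc, hA₁, mul_assoc])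
  have hb := ptrans_inv_ptrans_mul_embInvT (R := R) hd (hLt N) (hfB M N hMN).1
    (hfB M N hMN).2 hB
  have hc := ptrans_inv_ptrans_mul_embInvT (R := R) hd.symm (hLt M) (hfC M N hMN).1
    (hfC M N hMN).2 hC
  have hk := hK M N hMN
  have hNK := (embInvT_commute_embS hd.symm (L N) (K M)).eq
  have hMK := (embInvT_commute_embS hd (L M) (K N)).eq
  have hPQ : embInvT R M (L M) * embInvT R N (L N) = embInvT R N (L N) * embInvT R M (L M) :=
    (embInvT_commute_embS hd _ _).eq
  simp only [embS_mul]
  simp only [← embInvT.eq_def]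
  exact exchange_of_twist hk ha hb hc hNK hMK hPQ

end QT
end

section
/- Let {T_M} and {K_M}, with T_M, K_M ∈ End(V^{⊗M})⊗R, be families indexed by ordered label sets such that every matrix entry of every T_M commutes in R with every matrix entry of every K_M. Assume for all disjoint ordered label sets M, N′: (i) the KS-type fused exchange relation A_{MN̄′} T_M B_{MN′} T_{N′} = T_{N′} C_{MN′} T_M D_{MN̄′}, and (ii) the fused dual exchange relation (A_{MN̄′}⁻¹)^{t_M t_{N′}} K_M ((B_{MN′}^{t_M})⁻¹)^{t_{N′}} K_{N′} = K_{N′} ((C_{MN′}^{t_{N′}})⁻¹)^{t_M} K_M (D_{MN̄′}^{t_M t_{N′}})⁻¹, where the scalar matrices A_{MN̄′}, D_{MN̄′}, B_{MN′}^{t_M}, C_{MN′}^{t_{N′}} are invertible. Then the elements H_M := Tr_{V^{⊗M}}(K_M^{t_M} T_M) ∈ R mutually commute: H_M H_{N′} = H_{N′} H_M for all disjoint ordered label sets M, N′. -/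
open Matrix

namespace QT

variable {n : ℕ} {ι : Type*} [Fintype ι] [DecidableEq ι] {α : Type*}
variable {R : Type*} [Ring R] [Algebra ℂ R]

open scoped Kronecker

section PartialTranspose

variable {a c : Type*} [Fintype a] [Fintype c] [DecidableEq a] [DecidableEq c]

/-- Entrywise pairing `∑ X p q * Y p q` of two matrices. -/
def pairing {p : Type*} [Fintype p] (X Y : Matrix p p R) : R := ∑ f, ∑ g, X f g * Y f g

/-- Transposition in the first factor of a matrix on a product index set. -/
def transposeFst {α : Type*} (X : Matrix (a × c) (a × c) α) : Matrix (a × c) (a × c) α :=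
  Matrix.of fun p q => X (q.1, p.2) (p.1, q.2)

/-- Transposition in the second factor of a matrix on a product index set. -/
def transposeSnd {α : Type*} (X : Matrix (a × c) (a × c) α) : Matrix (a × c) (a × c) α :=
  Matrix.of fun p q => X (p.1, q.2) (q.1, p.2)

omit [Algebra ℂ R] in
lemma pairing_eq_trace {p : Type*} [Fintype p] (X Y : Matrix p p R) :
    pairing X Y = Matrix.trace (Xᵀ * Y) := by
  simp only [pairing, Matrix.trace, Matrix.diag, Matrix.mul_apply, Matrix.transpose_apply]
  exact Finset.sum_comm

omit [Algebra ℂ R] in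
lemma pairing_transpose {p : Type*} [Fintype p] (X Y : Matrix p p R) :
    pairing Xᵀ Yᵀ = pairing X Y := by
  simp only [pairing, Matrix.transpose_apply]
  exact Finset.sum_comm

lemma transpose_scalar_mul {p : Type*} [Fintype p] (A : Matrix p p ℂ) (X : Matrix p p R) :
    (A.map (algebraMap ℂ R) * X)ᵀ = Xᵀ * Aᵀ.map (algebraMap ℂ R) := by
  ext f g
  simp only [Matrix.transpose_apply, Matrix.mul_apply, Matrix.map_apply]
  exact Finset.sum_congr rfl fun h _ => Algebra.commutes _ _

lemma transpose_mul_scalar {p : Type*} [Fintype p] (A : Matrix p p ℂ) (X : Matrix p p R) :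
    (X * A.map (algebraMap ℂ R))ᵀ = Aᵀ.map (algebraMap ℂ R) * Xᵀ := by
  ext f g
  simp only [Matrix.transpose_apply, Matrix.mul_apply, Matrix.map_apply]
  exact Finset.sum_congr rfl fun h _ => (Algebra.commutes _ _).symm

lemma pairing_scalar_mul {p : Type*} [Fintype p] [DecidableEq p] (A A' : Matrix p p ℂ)
    (h : A'ᵀ * A = 1) (X Y : Matrix p p R) :
    pairing (A'.map (algebraMap ℂ R) * X) (A.map (algebraMap ℂ R) * Y) = pairing X Y := by
  rw [pairing_eq_trace, pairing_eq_trace, transpose_scalar_mul, Matrix.mul_assoc,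
    ← Matrix.mul_assoc (A'ᵀ.map _), ← Matrix.map_mul, h,
    Matrix.map_one _ (map_zero _) (map_one _), Matrix.one_mul]

lemma pairing_mul_scalar {p : Type*} [Fintype p] [DecidableEq p] (D D' : Matrix p p ℂ)
    (h : D' * Dᵀ = 1) (X Y : Matrix p p R) :
    pairing (X * D'.map (algebraMap ℂ R)) (Y * D.map (algebraMap ℂ R)) = pairing X Y := by
  rw [← pairing_transpose, transpose_mul_scalar, transpose_mul_scalar, pairing_scalar_mul,
    pairing_transpose]
  rwa [Matrix.transpose_transpose]

omit [Algebra ℂ R] [DecidableEq a] [DecidableEq c] in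
lemma pairing_transposeFst (X Y : Matrix (a × c) (a × c) R) :
    pairing (transposeFst X) (transposeFst Y) = pairing X Y := by
  simp only [pairing, transposeFst, Matrix.of_apply, Fintype.sum_prod_type]
  rw [Finset.sum_congr rfl fun x _ => Finset.sum_comm]
  rw [Finset.sum_comm]
  exact Finset.sum_congr rfl fun x _ => Finset.sum_comm

omit [Algebra ℂ R] [DecidableEq a] [DecidableEq c] in
lemma pairing_transposeSnd (X Y : Matrix (a × c) (a × c) R) :
    pairing (transposeSnd X) (transposeSnd Y) = pairing X Y := by
  rw [← pairing_transposeFst, ← pairing_transpose]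
  rfl

lemma transposeFst_kronecker_mul (X : Matrix a a R) (Y : Matrix c c R)
    (Z : Matrix (a × c) (a × c) ℂ) :
    transposeFst ((X ⊗ₖ (1 : Matrix c c R)) * Z.map (algebraMap ℂ R) *
        ((1 : Matrix a a R) ⊗ₖ Y))
      = (transposeFst Z).map (algebraMap ℂ R) *
        (Matrix.of fun p q => X q.1 p.1 * Y p.2 q.2) := by
  ext ⟨i, j⟩ ⟨k, l⟩
  simp only [transposeFst, Matrix.of_apply, Matrix.mul_apply, Matrix.kronecker_apply,
    Matrix.map_apply, Fintype.sum_prod_type, Matrix.one_apply]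
  simp only [mul_ite, ite_mul, mul_one, one_mul, mul_zero, zero_mul, Finset.sum_ite_eq,
    Finset.sum_ite_eq', Finset.mem_univ, if_true, Finset.sum_ite_irrel, Finset.sum_const_zero,
    Finset.sum_mul]
  rw [Finset.sum_comm]
  refine Finset.sum_congr rfl fun x _ => Finset.sum_congr rfl fun y _ => ?_
  rw [← Algebra.commutes, mul_assoc]

lemma transposeSnd_kronecker_mul (X : Matrix a a R) (Y : Matrix c c R)
    (Z : Matrix (a × c) (a × c) ℂ) :
    transposeSnd (((1 : Matrix a a R) ⊗ₖ Y) * Z.map (algebraMap ℂ R) *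
        (X ⊗ₖ (1 : Matrix c c R)))
      = (transposeSnd Z).map (algebraMap ℂ R) *
        (Matrix.of fun p q => Y q.2 p.2 * X p.1 q.1) := by
  ext ⟨i, j⟩ ⟨k, l⟩
  simp only [transposeSnd, Matrix.of_apply, Matrix.mul_apply, Matrix.kronecker_apply,
    Matrix.map_apply, Fintype.sum_prod_type, Matrix.one_apply]
  simp only [mul_ite, ite_mul, mul_one, one_mul, mul_zero, zero_mul, Finset.sum_ite_eq,
    Finset.sum_ite_eq', Finset.mem_univ, if_true, Finset.sum_ite_irrel, Finset.sum_const_zero,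
    Finset.sum_mul]
  refine Finset.sum_congr rfl fun x _ => Finset.sum_congr rfl fun y _ => ?_
  rw [← Algebra.commutes, mul_assoc]

lemma pairing_sandwich_fst (K T : Matrix a a R) (K' T' : Matrix c c R)
    (hcomm : ∀ i j k l, Commute (T i j) (K' k l)) (B : Matrix (a × c) (a × c) ℂ)
    (hB : IsUnit (transposeFst B)) :
    pairing ((K ⊗ₖ (1 : Matrix c c R)) *
          (transposeSnd (transposeFst B)⁻¹).map (algebraMap ℂ R) * ((1 : Matrix a a R) ⊗ₖ K'))
        ((T ⊗ₖ (1 : Matrix c c R)) * B.map (algebraMap ℂ R) * ((1 : Matrix a a R) ⊗ₖ T'))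
      = Matrix.trace (Kᵀ * T) * Matrix.trace (K'ᵀ * T') := by
  rw [← pairing_transposeFst, transposeFst_kronecker_mul, transposeFst_kronecker_mul,
    pairing_scalar_mul]
  · rw [← pairing_eq_trace, ← pairing_eq_trace, ← pairing_transpose K]
    simp only [pairing, Matrix.of_apply, Matrix.transpose_apply, Fintype.sum_prod_type,
      Finset.sum_mul_sum]
    refine Finset.sum_congr rfl fun i _ => Finset.sum_congr rfl fun j _ => ?_
    refine Finset.sum_congr rfl fun k _ => Finset.sum_congr rfl fun l _ => ?_
    rw [mul_assoc, mul_assoc, ← mul_assoc (K' _ _), ← (hcomm _ _ _ _).eq, mul_assoc]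
  · exact Matrix.nonsing_inv_mul _ ((Matrix.isUnit_iff_isUnit_det _).1 hB)

lemma pairing_sandwich_snd (K T : Matrix a a R) (K' T' : Matrix c c R)
    (hcomm : ∀ i j k l, Commute (T' i j) (K k l)) (C : Matrix (a × c) (a × c) ℂ)
    (hC : IsUnit (transposeSnd C)) :
    pairing (((1 : Matrix a a R) ⊗ₖ K') *
          (transposeFst (transposeSnd C)⁻¹).map (algebraMap ℂ R) * (K ⊗ₖ (1 : Matrix c c R)))
        (((1 : Matrix a a R) ⊗ₖ T') * C.map (algebraMap ℂ R) * (T ⊗ₖ (1 : Matrix c c R)))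
      = Matrix.trace (K'ᵀ * T') * Matrix.trace (Kᵀ * T) := by
  rw [← pairing_transposeSnd, transposeSnd_kronecker_mul, transposeSnd_kronecker_mul,
    pairing_scalar_mul]
  · rw [← pairing_eq_trace, ← pairing_eq_trace, ← pairing_transpose K']
    simp only [pairing, Matrix.of_apply, Matrix.transpose_apply, Fintype.sum_prod_type,
      Finset.sum_mul_sum]
    rw [Finset.sum_comm]
    refine Finset.sum_congr rfl fun i _ => Finset.sum_congr rfl fun j _ => ?_
    rw [Finset.sum_comm]
    refine Finset.sum_congr rfl fun k _ => Finset.sum_congr rfl fun l _ => ?_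
    rw [mul_assoc, mul_assoc, ← mul_assoc (K _ _), ← (hcomm _ _ _ _).eq, mul_assoc]
  · exact Matrix.nonsing_inv_mul _ ((Matrix.isUnit_iff_isUnit_det _).1 hC)

/-- Commutation of quantum traces on a product of two index sets. -/
lemma trace_mul_trace_comm_of_exchange (A B C D : Matrix (a × c) (a × c) ℂ)
    (K T : Matrix a a R) (K' T' : Matrix c c R)
    (hcomm : ∀ i j k l, Commute (T i j) (K' k l))
    (hcomm' : ∀ i j k l, Commute (T' i j) (K k l))
    (hA : IsUnit A) (hB : IsUnit (transposeFst B)) (hC : IsUnit (transposeSnd C)) (hD : IsUnit D)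
    (hT : A.map (algebraMap ℂ R) * (T ⊗ₖ (1 : Matrix c c R)) * B.map (algebraMap ℂ R) *
        ((1 : Matrix a a R) ⊗ₖ T')
      = ((1 : Matrix a a R) ⊗ₖ T') * C.map (algebraMap ℂ R) *
        (T ⊗ₖ (1 : Matrix c c R)) * D.map (algebraMap ℂ R))
    (hK : (transposeSnd (transposeFst A⁻¹)).map (algebraMap ℂ R) *
        (K ⊗ₖ (1 : Matrix c c R)) *
        (transposeSnd (transposeFst B)⁻¹).map (algebraMap ℂ R) * ((1 : Matrix a a R) ⊗ₖ K')
      = ((1 : Matrix a a R) ⊗ₖ K') *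
        (transposeFst (transposeSnd C)⁻¹).map (algebraMap ℂ R) * (K ⊗ₖ (1 : Matrix c c R)) *
        ((transposeSnd (transposeFst D))⁻¹).map (algebraMap ℂ R)) :
    Matrix.trace (Kᵀ * T) * Matrix.trace (K'ᵀ * T')
      = Matrix.trace (K'ᵀ * T') * Matrix.trace (Kᵀ * T) := by
  have key := congrArg₂ pairing hK hT
  rw [pairing_mul_scalar, pairing_sandwich_snd K T K' T' hcomm' C hC] at key
  · rw [← key]
    simp only [Matrix.mul_assoc]
    rw [pairing_scalar_mul]
    · rw [← pairing_sandwich_fst K T K' T' hcomm B hB]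
      simp only [Matrix.mul_assoc]
    · exact Matrix.nonsing_inv_mul _ ((Matrix.isUnit_iff_isUnit_det _).1 hA)
  · refine Matrix.nonsing_inv_mul Dᵀ ?_
    rw [Matrix.det_transpose]
    exact (Matrix.isUnit_iff_isUnit_det _).1 hD

end PartialTranspose

section Restriction

/-- `X` vanishes on pairs of multi-indices which differ outside `S`. -/
def DiagOff [Zero α] (S : Finset ι) (X : Tens ι n α) : Prop :=
  ∀ f g, ∀ k ∉ S, f k ≠ g k → X f g = 0

lemma DiagOff.mul [Semiring α] {S : Finset ι} {X Y : Tens ι n α}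
    (hX : DiagOff S X) (hY : DiagOff S Y) : DiagOff S (X * Y) := by
  intro f g k hk hfg
  rw [Matrix.mul_apply]
  refine Finset.sum_eq_zero fun h _ => ?_
  by_cases hf : f k = h k
  · rw [hY h g k hk (hf ▸ hfg), mul_zero]
  · rw [hX f h k hk hf, zero_mul]

lemma DiagOff.list_prod [Semiring α] {S : Finset ι} {l : List (Tens ι n α)}
    (h : ∀ X ∈ l, DiagOff S X) : DiagOff S l.prod := by
  induction l with
  | nil =>
    intro f g k _ hfg
    rw [List.prod_nil, Matrix.one_apply_ne fun e => hfg (congrFun e k)]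
  | cons X l ih =>
    rw [List.prod_cons]
    exact (h X (by simp)).mul (ih fun Y hY => h Y (by simp [hY]))

lemma DiagOff.inv {S : Finset ι} {X : Tens ι n ℂ} (hX : DiagOff S X) (hu : IsUnit X) :
    DiagOff S X⁻¹ := by
  intro f g k hk hfg
  let d : Tens ι n ℂ := Matrix.diagonal fun f => ((f k : ℕ) : ℂ)
  have hd : d * X = X * d := by
    ext f g
    simp only [d, Matrix.diagonal_mul, Matrix.mul_diagonal]
    by_cases hfg : f k = g k
    · rw [hfg, mul_comm]
    · rw [hX f g k hk hfg, mul_zero, zero_mul]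
  have hdet := (Matrix.isUnit_iff_isUnit_det X).1 hu
  have hd' : X⁻¹ * d = d * X⁻¹ := by
    calc X⁻¹ * d = X⁻¹ * (d * X) * X⁻¹ := by
          rw [Matrix.mul_assoc, Matrix.mul_assoc, Matrix.mul_nonsing_inv _ hdet, Matrix.mul_one]
      _ = d * X⁻¹ := by
          rw [hd, ← Matrix.mul_assoc, Matrix.nonsing_inv_mul _ hdet, Matrix.one_mul]
  have he := congrFun (congrFun hd' f) g
  simp only [d, Matrix.diagonal_mul, Matrix.mul_diagonal] at he
  have hne : ((g k : ℕ) : ℂ) - ((f k : ℕ) : ℂ) ≠ 0 := by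
    rw [sub_ne_zero]
    exact fun e => hfg (Fin.ext (Nat.cast_injective e)).symm
  refine (mul_eq_zero.1 (?_ : (((g k : ℕ) : ℂ) - ((f k : ℕ) : ℂ)) * X⁻¹ f g = 0)).resolve_left hne
  rw [sub_mul, ← he, mul_comm, sub_self]

omit [Fintype ι] in
lemma DiagOff.ptrans [Zero α] {S : Finset ι} {X : Tens ι n α} (hX : DiagOff S X)
    {U : Finset ι} (hU : U ⊆ S) : DiagOff S (ptrans U X) := by
  intro f g k hk hfg
  have hkU : k ∉ U := fun h => hk (hU h)
  exact hX _ _ k hk (by simpa [hkU] using hfg)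

omit [Fintype ι] [DecidableEq ι] in
lemma DiagOff.map {S : Finset ι} {X : Tens ι n ℂ} (hX : DiagOff S X) :
    DiagOff S (X.map (algebraMap ℂ R)) := by
  intro f g k hk hfg
  rw [Matrix.map_apply, hX f g k hk hfg, map_zero]

lemma diagOff_fuse (X : M2 n ℂ) (M N : List ι) (S : Finset ι) (hM : ∀ i ∈ M, i ∈ S)
    (hN : ∀ j ∈ N, j ∈ S) : DiagOff S (fuse X M N) := by
  refine DiagOff.list_prod fun Y hY => ?_
  obtain ⟨i, hi, rfl⟩ := List.mem_map.1 hY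
  refine DiagOff.list_prod fun Y hY => ?_
  obtain ⟨j, hj, rfl⟩ := List.mem_map.1 hY
  intro f g k hk hfg
  rw [emb2, Matrix.of_apply, if_neg]
  exact fun h => hfg (h k (fun e => hk (e ▸ hM i hi)) fun e => hk (e ▸ hN j hj))

lemma diagOff_embS [Zero α] (M : List ι) (X : Matrix (idx n M) (idx n M) α) {S : Finset ι}
    (hS : M.toFinset ⊆ S) : DiagOff S (embS M X) := by
  intro f g k hk hfg
  rw [embS, Matrix.of_apply, if_neg]
  exact fun h => hfg (h k fun hkM => hk (hS hkM))

/-- The multi-index with prescribed values on `M` and `N`, equal to `o` elsewhere. -/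
def glue (M N : List ι) (o : ι → Fin n) (p : idx n M × idx n N) : ι → Fin n := fun k =>
  if h : k ∈ M.toFinset then p.1 ⟨k, h⟩ else if h : k ∈ N.toFinset then p.2 ⟨k, h⟩ else o k

variable {M N : List ι} {o : ι → Fin n}

omit [Fintype ι] in
lemma glue_fst (p : idx n M × idx n N) (i : {x // x ∈ M.toFinset}) :
    glue M N o p i.1 = p.1 i := by
  simp only [glue, dif_pos i.2]

omit [Fintype ι] in
lemma glue_snd (hMN : M.Disjoint N) (p : idx n M × idx n N) (i : {x // x ∈ N.toFinset}) :
    glue M N o p i.1 = p.2 i := by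
  have : i.1 ∉ M.toFinset := fun h => hMN (List.mem_toFinset.1 h) (List.mem_toFinset.1 i.2)
  simp only [glue, dif_neg this, dif_pos i.2]

omit [Fintype ι] in
lemma glue_off (p : idx n M × idx n N) {k : ι} (hk : k ∉ M.toFinset ∪ N.toFinset) :
    glue M N o p k = o k := by
  rw [Finset.mem_union, not_or] at hk
  simp only [glue, dif_neg hk.1, dif_neg hk.2]

omit [Fintype ι] in
lemma glue_injective (hMN : M.Disjoint N) : Function.Injective (glue M N o) := by
  intro p q h
  refine Prod.ext (funext fun i => ?_) (funext fun i => ?_)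
  · rw [← glue_fst (o := o) p i, h, glue_fst]
  · rw [← glue_snd (o := o) hMN p i, h, glue_snd hMN]

omit [Fintype ι] in
lemma exists_glue_eq (hMN : M.Disjoint N) (f : ι → Fin n)
    (hf : ∀ k ∉ M.toFinset ∪ N.toFinset, f k = o k) : ∃ p, glue M N o p = f := by
  refine ⟨⟨fun i => f i.1, fun i => f i.1⟩, funext fun k => ?_⟩
  by_cases hM : k ∈ M.toFinset
  · exact glue_fst _ ⟨k, hM⟩
  by_cases hN : k ∈ N.toFinset
  · exact glue_snd hMN _ ⟨k, hN⟩
  have hk : k ∉ M.toFinset ∪ N.toFinset := by simp only [Finset.mem_union, hM, hN, or_self,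
    not_false_eq_true]
  rw [glue_off _ hk, hf k hk]

lemma submatrix_glue_mul [Semiring α] (hMN : M.Disjoint N) {X : Tens ι n α}
    (hX : DiagOff (M.toFinset ∪ N.toFinset) X) (Y : Tens ι n α) :
    (X * Y).submatrix (glue M N o) (glue M N o)
      = X.submatrix (glue M N o) (glue M N o) * Y.submatrix (glue M N o) (glue M N o) := by
  ext p q
  simp only [Matrix.submatrix_apply, Matrix.mul_apply]
  refine (Fintype.sum_of_injective _ (glue_injective (o := o) hMN) _ _ (fun h hh => ?_)
    fun _ => rfl).symm
  have : ∃ k ∉ M.toFinset ∪ N.toFinset, h k ≠ o k := by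
    by_contra! hc
    exact hh (exists_glue_eq hMN h hc)
  obtain ⟨k, hk, hne⟩ := this
  rw [hX _ _ k hk (by rw [glue_off _ hk]; exact hne.symm), zero_mul]

lemma submatrix_glue_mul_inv (hMN : M.Disjoint N) {X : Tens ι n ℂ}
    (hX : DiagOff (M.toFinset ∪ N.toFinset) X) (hu : IsUnit X) :
    X.submatrix (glue M N o) (glue M N o) * X⁻¹.submatrix (glue M N o) (glue M N o) = 1 := by
  rw [← submatrix_glue_mul hMN hX,
    Matrix.mul_nonsing_inv _ ((Matrix.isUnit_iff_isUnit_det _).1 hu),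
    Matrix.submatrix_one _ (glue_injective hMN)]

lemma submatrix_glue_inv (hMN : M.Disjoint N) {X : Tens ι n ℂ}
    (hX : DiagOff (M.toFinset ∪ N.toFinset) X) (hu : IsUnit X) :
    X⁻¹.submatrix (glue M N o) (glue M N o) = (X.submatrix (glue M N o) (glue M N o))⁻¹ :=
  (Matrix.inv_eq_right_inv (submatrix_glue_mul_inv hMN hX hu)).symm

lemma isUnit_submatrix_glue (hMN : M.Disjoint N) {X : Tens ι n ℂ}
    (hX : DiagOff (M.toFinset ∪ N.toFinset) X) (hu : IsUnit X) :
    IsUnit (X.submatrix (glue M N o) (glue M N o)) :=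
  IsUnit.of_mul_eq_one _ (submatrix_glue_mul_inv hMN hX hu)

omit [Fintype ι] in
lemma submatrix_glue_ptrans_fst (X : Tens ι n α) :
    (ptrans M.toFinset X).submatrix (glue M N o) (glue M N o)
      = transposeFst (X.submatrix (glue M N o) (glue M N o)) := by
  ext p q
  simp only [ptrans, transposeFst, Matrix.submatrix_apply, Matrix.of_apply]
  congr 1 <;> funext k <;> by_cases hM : k ∈ M.toFinset <;> simp only [glue, hM, if_true,
    if_false, dite_true, dite_false]

omit [Fintype ι] in
lemma submatrix_glue_ptrans_snd (hMN : M.Disjoint N) (X : Tens ι n α) :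
    (ptrans N.toFinset X).submatrix (glue M N o) (glue M N o)
      = transposeSnd (X.submatrix (glue M N o) (glue M N o)) := by
  ext p q
  simp only [ptrans, transposeSnd, Matrix.submatrix_apply, Matrix.of_apply]
  congr 1 <;> funext k <;> by_cases hM : k ∈ M.toFinset
  · have hN : k ∉ N.toFinset := fun h => hMN (List.mem_toFinset.1 hM) (List.mem_toFinset.1 h)
    simp only [glue, hM, hN, if_false, dite_true]
  · by_cases hN : k ∈ N.toFinset <;> simp only [glue, hM, hN, if_true, if_false, dite_true,
      dite_false]
  · have hN : k ∉ N.toFinset := fun h => hMN (List.mem_toFinset.1 hM) (List.mem_toFinset.1 h)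
    simp only [glue, hM, hN, if_false, dite_true]
  · by_cases hN : k ∈ N.toFinset <;> simp only [glue, hM, hN, if_true, if_false, dite_true,
      dite_false]

lemma submatrix_glue_embS_fst [Semiring α] (hMN : M.Disjoint N)
    (X : Matrix (idx n M) (idx n M) α) :
    (embS M X).submatrix (glue M N o) (glue M N o)
      = X ⊗ₖ (1 : Matrix (idx n N) (idx n N) α) := by
  ext ⟨p, p'⟩ ⟨q, q'⟩
  simp only [embS, Matrix.submatrix_apply, Matrix.of_apply, glue_fst, Matrix.kronecker_apply,
    Matrix.one_apply, mul_ite, mul_one, mul_zero]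
  refine if_congr ⟨fun h => funext fun i => ?_, fun h k hk => ?_⟩ rfl rfl
  · refine (glue_snd (o := o) hMN (p, p') i).symm.trans (.trans ?_ (glue_snd (o := o) hMN (q, q') i))
    exact h i.1 fun hM => hMN (List.mem_toFinset.1 hM) (List.mem_toFinset.1 i.2)
  · simp only [glue, dif_neg hk, h]

lemma submatrix_glue_embS_snd [Semiring α] (hMN : M.Disjoint N)
    (X : Matrix (idx n N) (idx n N) α) :
    (embS N X).submatrix (glue M N o) (glue M N o)
      = (1 : Matrix (idx n M) (idx n M) α) ⊗ₖ X := by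
  ext ⟨p, p'⟩ ⟨q, q'⟩
  simp only [embS, Matrix.submatrix_apply, Matrix.of_apply, glue_snd hMN, Matrix.kronecker_apply,
    Matrix.one_apply, ite_mul, one_mul, zero_mul]
  refine if_congr ⟨fun h => funext fun i => ?_, fun h k hk => ?_⟩ rfl rfl
  · refine (glue_fst (o := o) (p, p') i).symm.trans (.trans ?_ (glue_fst (o := o) (q, q') i))
    exact h i.1 fun hN => hMN (List.mem_toFinset.1 i.2) (List.mem_toFinset.1 hN)
  · simp only [glue, dif_neg hk, h]

end Restriction

/-- commuting quantum traces from the KS-type fusion. -/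
theorem commuting_traces_KS {n : ℕ} (hn : 1 ≤ n)
    {ι : Type} [Fintype ι] [DecidableEq ι]
    {R : Type*} [Ring R] [Algebra ℂ R]
    (A B C D : M2 n ℂ)
    (T K : (M : List ι) → Matrix (idx n M) (idx n M) R)
    (hcomm : ∀ (M N : List ι) a b c d, Commute (T M a b) (K N c d))
    (hinv : ∀ M N : List ι, OkPair M N →
      IsUnit (fuse A M N.reverse) ∧ IsUnit (fuse D M N.reverse) ∧
      IsUnit (ptrans M.toFinset (fuse B M N)) ∧
      IsUnit (ptrans N.toFinset (fuse C M N)))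
    (hT : ∀ M N : List ι, OkPair M N →
      (fuse A M N.reverse).map (algebraMap ℂ R) * embS M (T M) *
        (fuse B M N).map (algebraMap ℂ R) * embS N (T N)
      = embS N (T N) * (fuse C M N).map (algebraMap ℂ R) * embS M (T M) *
        (fuse D M N.reverse).map (algebraMap ℂ R))
    (hK : ∀ M N : List ι, OkPair M N →
      (ptrans N.toFinset (ptrans M.toFinset ((fuse A M N.reverse)⁻¹))).map (algebraMap ℂ R) *
        embS M (K M) *
        (ptrans N.toFinset ((ptrans M.toFinset (fuse B M N))⁻¹)).map (algebraMap ℂ R) *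
        embS N (K N)
      = embS N (K N) *
        (ptrans M.toFinset ((ptrans N.toFinset (fuse C M N))⁻¹)).map (algebraMap ℂ R) *
        embS M (K M) *
        ((ptrans N.toFinset (ptrans M.toFinset (fuse D M N.reverse)))⁻¹).map (algebraMap ℂ R)) :
    ∀ M N : List ι, OkPair M N →
      Matrix.trace ((K M)ᵀ * T M) * Matrix.trace ((K N)ᵀ * T N)
        = Matrix.trace ((K N)ᵀ * T N) * Matrix.trace ((K M)ᵀ * T M) := by
  intro M N hok
  obtain ⟨hA, hD, hB, hC⟩ := hinv M N hok
  have hMN := hok.2.2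
  let o : ι → Fin n := fun _ => ⟨0, hn⟩
  have hM : M.toFinset ⊆ M.toFinset ∪ N.toFinset := Finset.subset_union_left
  have hN : N.toFinset ⊆ M.toFinset ∪ N.toFinset := Finset.subset_union_right
  have hfuse (X : M2 n ℂ) : DiagOff (M.toFinset ∪ N.toFinset) (fuse X M N) :=
    diagOff_fuse X M N _ (fun i hi => hM (List.mem_toFinset.2 hi))
      fun i hi => hN (List.mem_toFinset.2 hi)
  have hfuse' (X : M2 n ℂ) : DiagOff (M.toFinset ∪ N.toFinset) (fuse X M N.reverse) :=
    diagOff_fuse X M _ _ (fun i hi => hM (List.mem_toFinset.2 hi))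
      fun i hi => hN (List.mem_toFinset.2 (List.mem_reverse.1 hi))
  have hBt := (hfuse B).ptrans hM
  have hCt := (hfuse C).ptrans hN
  have hDt : IsUnit (ptrans N.toFinset (ptrans M.toFinset (fuse D M N.reverse))) := by
    have he : ptrans N.toFinset (ptrans M.toFinset (fuse D M N.reverse))
        = (fuse D M N.reverse)ᵀ := by
      ext f g
      by_cases h : ∃ k ∉ M.toFinset ∪ N.toFinset, f k ≠ g k
      · obtain ⟨k, hk, hne⟩ := h
        rw [((hfuse' D).ptrans hM).ptrans hN f g k hk hne, Matrix.transpose_apply,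
          hfuse' D g f k hk hne.symm]
      · push Not at h
        simp only [ptrans, Matrix.of_apply, Matrix.transpose_apply]
        congr 1 <;> funext k <;> by_cases hkM : k ∈ M.toFinset
        · have hkN : k ∉ N.toFinset := fun h' =>
            hMN (List.mem_toFinset.1 hkM) (List.mem_toFinset.1 h')
          simp only [hkM, hkN, if_true, if_false]
        · by_cases hkN : k ∈ N.toFinset
          · simp only [hkM, hkN, if_true, if_false]
          · simp only [hkM, hkN, if_false]
            exact h k (by simp only [Finset.mem_union, hkM, hkN, or_self, not_false_eq_true])
        · have hkN : k ∉ N.toFinset := fun h' =>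
            hMN (List.mem_toFinset.1 hkM) (List.mem_toFinset.1 h')
          simp only [hkM, hkN, if_true, if_false]
        · by_cases hkN : k ∈ N.toFinset
          · simp only [hkM, hkN, if_true, if_false]
          · simp only [hkM, hkN, if_false]
            exact (h k (by simp only [Finset.mem_union, hkM, hkN, or_self,
              not_false_eq_true])).symm
    rw [he, Matrix.isUnit_transpose]
    exact hD
  have hT' := congrArg (fun X => X.submatrix (glue M N o) (glue M N o)) (hT M N hok)
  have hK' := congrArg (fun X => X.submatrix (glue M N o) (glue M N o)) (hK M N hok)
  have eT (X : Matrix (idx n M) (idx n M) R) := diagOff_embS (n := n) M X hM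
  have eT' (X : Matrix (idx n N) (idx n N) R) := diagOff_embS (n := n) N X hN
  simp only [Matrix.mul_assoc] at hT' hK'
  rw [submatrix_glue_mul hMN (hfuse' A).map, submatrix_glue_mul hMN (eT _),
    submatrix_glue_mul hMN (hfuse B).map, submatrix_glue_mul hMN (eT' _),
    submatrix_glue_mul hMN (hfuse C).map, submatrix_glue_mul hMN (eT _)] at hT'
  rw [submatrix_glue_mul hMN ((((hfuse' A).inv hA).ptrans hM).ptrans hN).map,
    submatrix_glue_mul hMN (eT _),
    submatrix_glue_mul hMN ((hBt.inv hB).ptrans hN).map, submatrix_glue_mul hMN (eT' _),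
    submatrix_glue_mul hMN ((hCt.inv hC).ptrans hM).map, submatrix_glue_mul hMN (eT _)] at hK'
  simp only [Matrix.submatrix_map, submatrix_glue_ptrans_fst, submatrix_glue_ptrans_snd hMN,
    submatrix_glue_embS_fst hMN, submatrix_glue_embS_snd hMN,
    submatrix_glue_inv hMN (hfuse' A) hA, submatrix_glue_inv hMN hBt hB,
    submatrix_glue_inv hMN hCt hC,
    submatrix_glue_inv hMN (((hfuse' D).ptrans hM).ptrans hN) hDt] at hT' hK'
  refine trace_mul_trace_comm_of_exchange _ ((fuse B M N).submatrix (glue M N o) (glue M N o))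
    ((fuse C M N).submatrix (glue M N o) (glue M N o)) _ _ _ _ _
    (fun _ _ _ _ => hcomm _ _ _ _ _ _) (fun _ _ _ _ => hcomm _ _ _ _ _ _)
    (isUnit_submatrix_glue (o := o) hMN (hfuse' A) hA) ?_ ?_
    (isUnit_submatrix_glue (o := o) hMN (hfuse' D) hD) ?_ ?_
  · rw [← submatrix_glue_ptrans_fst]
    exact isUnit_submatrix_glue hMN hBt hB
  · rw [← submatrix_glue_ptrans_snd hMN]
    exact isUnit_submatrix_glue hMN hCt hC
  · simpa only [Matrix.mul_assoc] using hT'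
  · simpa only [Matrix.mul_assoc] using hK'

end QT
end
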